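/- Let p ∈ [1,∞) and L > 0. Let P_{p,L}(ℝ^N) denote the set of μ ∈ P_p(ℝ^N) that are triangular L-Lipschitz, i.e. for each k ≤ N the map (x_1,…,x_{k-1}) ↦ K^μ_k(x_1,…,x_{k-1}) (the conditional law of x_k given x_1,…,x_{k-1} under μ) is L-Lipschitz from ℝ^{k-1} to (P_p(ℝ), W_p). Then there exists a constant C > 0 such that for all μ, ν ∈ P_{p,L}(ℝ^N): AW_p(μ,ν) ≤ KR_p(μ,ν) ≤ C · AW_p(μ,ν). -/

import Mathlib

open MeasureTheory ProbabilityTheory Filter Set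
open scoped ENNReal NNReal Topology

/-- Lebesgue measure on `(0,1)`. -/
noncomputable def lambda01 : Measure ℝ := volume.restrict (Set.Ioo (0:ℝ) 1)

/-- The `N`-fold product of Lebesgue measure on `(0,1)`. -/
noncomputable def lambdaN (N : ℕ) : Measure (Fin N → ℝ) :=
  Measure.pi fun _ => lambda01

/-- The open unit cube `(0,1)^N`. -/
def cube (N : ℕ) : Set (Fin N → ℝ) := {u | ∀ i, u i ∈ Set.Ioo (0:ℝ) 1}

/-- A map is triangular (adapted) if its `k`-th component depends only on the first `k`
coordinates. -/
def Triangular {N : ℕ} (Q : (Fin N → ℝ) → Fin N → ℝ) : Prop :=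
  ∀ (k : Fin N) (u v : Fin N → ℝ), (∀ j ≤ k, u j = v j) → Q u k = Q v k

/-- Monotonicity condition (inc) on a set `s`: the `k`-th component is increasing in the
`k`-th coordinate (the earlier coordinates being fixed). -/
def IncOn {N : ℕ} (Q : (Fin N → ℝ) → Fin N → ℝ) (s : Set (Fin N → ℝ)) : Prop :=
  ∀ k : Fin N, ∀ u ∈ s, ∀ v ∈ s, (∀ j < k, u j = v j) → u k ≤ v k → Q u k ≤ Q v k

/-- Strict monotonicity condition (sinc) on a set `s`. -/
def StrictIncOn {N : ℕ} (Q : (Fin N → ℝ) → Fin N → ℝ) (s : Set (Fin N → ℝ)) : Prop :=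
  ∀ k : Fin N, ∀ u ∈ s, ∀ v ∈ s, (∀ j < k, u j = v j) → u k < v k → Q u k < Q v k

/-- Consistency condition (con) on a set `s`: if changing only the `k`-th coordinate does not
change the `k`-th component, then it does not change any later component `m ≥ k`. -/
def ConOn {N : ℕ} (Q : (Fin N → ℝ) → Fin N → ℝ) (s : Set (Fin N → ℝ)) : Prop :=
  ∀ k m : Fin N, k ≤ m → ∀ u ∈ s, ∀ v ∈ s, (∀ j ≠ k, u j = v j) →
    Q u k = Q v k → Q u m = Q v m

/-- A quantile process: a Borel triangular map satisfying (inc) and (con) on the unit cube. -/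
structure IsQuantileProcess {N : ℕ} (Q : (Fin N → ℝ) → Fin N → ℝ) : Prop where
  measurable : Measurable Q
  triangular : Triangular Q
  inc : IncOn Q (cube N)
  con : ConOn Q (cube N)

/-- The (a.e. unique) quantile process of `μ`, chosen via Hilbert's epsilon operator. -/
noncomputable def quantileProcess {N : ℕ} (μ : Measure (Fin N → ℝ)) :
    (Fin N → ℝ) → Fin N → ℝ :=
  Classical.epsilon fun Q => IsQuantileProcess Q ∧ (lambdaN N).map Q = μ

/-- The cost `|x - y|_p^p = ∑ₖ |xₖ - yₖ|^p`, valued in `ℝ≥0∞`. -/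
noncomputable def pCost (p : ℝ) {N : ℕ} (x y : Fin N → ℝ) : ℝ≥0∞ :=
  ∑ k, ENNReal.ofReal (|x k - y k| ^ p)

/-- The bounded cost `|x - y| ∧ 1` used for `p = 0`. -/
noncomputable def cost0 {N : ℕ} (x y : Fin N → ℝ) : ℝ≥0∞ :=
  ENNReal.ofReal (min ‖x - y‖ 1)

/-- The `L_p(λ^N; ℝ^N)`-distance of two maps `(0,1)^N → ℝ^N`
(for `p = 0` the distance `∫ |f - g| ∧ 1 dλ^N` of convergence in probability). -/
noncomputable def Ldist (p : ℝ) {N : ℕ} (f g : (Fin N → ℝ) → Fin N → ℝ) : ℝ≥0∞ :=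
  if p = 0 then ∫⁻ u, cost0 (f u) (g u) ∂(lambdaN N)
  else (∫⁻ u, pCost p (f u) (g u) ∂(lambdaN N)) ^ p⁻¹

/-- `μ ∈ P_p(ℝ^N)`: a Borel probability measure with finite `p`-th moments
(no moment condition when `p = 0`). -/
def MemPp (p : ℝ) {N : ℕ} (μ : Measure (Fin N → ℝ)) : Prop :=
  IsProbabilityMeasure μ ∧
    (p = 0 ∨ ∫⁻ x, ∑ k, ENNReal.ofReal (|x k| ^ p) ∂μ < ⊤)

/-- `T` is `p`-integrable w.r.t. `λ^N` (no condition when `p = 0`). -/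
def FinLp (p : ℝ) {N : ℕ} (T : (Fin N → ℝ) → Fin N → ℝ) : Prop :=
  p = 0 ∨ ∫⁻ u, ∑ k, ENNReal.ofReal (|T u k| ^ p) ∂(lambdaN N) < ⊤

/-- The Knothe–Rosenblatt distance `KR_p(μ,ν)` (for `p = 0` the metric
`∫ |Q^μ - Q^ν| ∧ 1 dλ^N`). -/
noncomputable def KRdist (p : ℝ) {N : ℕ} (μ ν : Measure (Fin N → ℝ)) : ℝ≥0∞ :=
  Ldist p (quantileProcess μ) (quantileProcess ν)

/-- `π` is a coupling of `μ` and `ν`. -/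
def IsCoupling {α β : Type*} [MeasurableSpace α] [MeasurableSpace β]
    (π : Measure (α × β)) (μ : Measure α) (ν : Measure β) : Prop :=
  π.map Prod.fst = μ ∧ π.map Prod.snd = ν

/-- `κ` is a disintegration (regular conditional law) of `ρ` w.r.t. its first coordinate. -/
def Disintegrates {α β : Type*} [MeasurableSpace α] [MeasurableSpace β]
    (ρ : Measure (α × β)) (κ : Kernel α β) : Prop :=
  ∀ (A : Set α) (B : Set β), MeasurableSet A → MeasurableSet B →
    ρ (A ×ˢ B) = ∫⁻ a in A, κ a B ∂(ρ.map Prod.fst)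

/-- The first `k` coordinates of `x : ℝ^N`. -/
def restr {N : ℕ} (k : Fin N) (x : Fin N → ℝ) : Fin (k : ℕ) → ℝ :=
  fun j => x ⟨j, j.isLt.trans k.isLt⟩

/-- A coupling `π` of `μ` and `ν` is bicausal if, for every `k`, the conditional law under `π`
of `(x_k, y_k)` given `(x_{1:k-1}, y_{1:k-1})` is a.s. a coupling of the conditional law of
`x_k` given `x_{1:k-1}` under `μ` and that of `y_k` given `y_{1:k-1}` under `ν`. -/
def IsBicausal {N : ℕ} (μ ν : Measure (Fin N → ℝ))
    (π : Measure ((Fin N → ℝ) × (Fin N → ℝ))) : Prop :=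
  IsCoupling π μ ν ∧
  ∀ k : Fin N,
    ∃ (κ : Kernel ((Fin (k : ℕ) → ℝ) × (Fin (k : ℕ) → ℝ)) (ℝ × ℝ))
      (κμ κν : Kernel (Fin (k : ℕ) → ℝ) ℝ),
      IsMarkovKernel κ ∧ IsMarkovKernel κμ ∧ IsMarkovKernel κν ∧
      Disintegrates (μ.map fun x => (restr k x, x k)) κμ ∧
      Disintegrates (ν.map fun y => (restr k y, y k)) κν ∧
      Disintegrates (π.map fun xy => ((restr k xy.1, restr k xy.2), (xy.1 k, xy.2 k))) κ ∧
      ∀ᵐ ab ∂(π.map fun xy => (restr k xy.1, restr k xy.2)),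
        IsCoupling (κ ab) (κμ ab.1) (κν ab.2)

/-- The adapted Wasserstein distance `AW_p` (for `p = 0` with cost `|x - y| ∧ 1`). -/
noncomputable def AWdist (p : ℝ) {N : ℕ} (μ ν : Measure (Fin N → ℝ)) : ℝ≥0∞ :=
  ⨅ (π : Measure ((Fin N → ℝ) × (Fin N → ℝ))) (_ : IsBicausal μ ν π),
    if p = 0 then ∫⁻ xy, cost0 xy.1 xy.2 ∂π
    else (∫⁻ xy, pCost p xy.1 xy.2 ∂π) ^ p⁻¹

/-- The `p`-Wasserstein distance on `P(ℝ)`. -/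
noncomputable def Wp (p : ℝ) (ρ σ : Measure ℝ) : ℝ≥0∞ :=
  ⨅ (π : Measure (ℝ × ℝ)) (_ : IsCoupling π ρ σ),
    (∫⁻ xy, ENNReal.ofReal (|xy.1 - xy.2| ^ p) ∂π) ^ p⁻¹

/-- `μ` is triangular `L`-Lipschitz: for each `k` there is a regular conditional law
`x_{1:k-1} ↦ K^μ_k(x_{1:k-1})` which is `L`-Lipschitz from `ℝ^{k-1}` (with the `p`-norm)
to `(P_p(ℝ), W_p)`. -/
def TriLipschitz (p L : ℝ) {N : ℕ} (μ : Measure (Fin N → ℝ)) : Prop :=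
  ∀ k : Fin N, ∃ κ : Kernel (Fin (k : ℕ) → ℝ) ℝ, IsMarkovKernel κ ∧
    Disintegrates (μ.map fun x => (restr k x, x k)) κ ∧
    ∀ a b : Fin (k : ℕ) → ℝ,
      Wp p (κ a) (κ b) ≤
        ENNReal.ofReal L * (∑ j, ENNReal.ofReal (|a j - b j| ^ p)) ^ p⁻¹

instance : IsProbabilityMeasure lambda01 := ⟨by simp [lambda01]⟩

instance (N : ℕ) : IsProbabilityMeasure (lambdaN N) := by
  unfold lambdaN; infer_instance

section MonotoneCoupling

lemma lintegral_Ioc_rpow {c : ℝ} (hc : 0 < c) {r : ℝ} (hr : 0 ≤ r) :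
    ∫⁻ s in Ioc 0 r, ENNReal.ofReal (c * s ^ (c - 1)) = ENNReal.ofReal (r ^ c) := by
  have hint : IntervalIntegrable (fun s : ℝ => c * s ^ (c - 1)) volume 0 r :=
    (intervalIntegral.intervalIntegrable_rpow' (by linarith)).const_mul c
  have hint' : IntegrableOn (fun s : ℝ => c * s ^ (c - 1)) (Ioc 0 r) volume :=
    (intervalIntegrable_iff_integrableOn_Ioc_of_le hr).1 hint
  rw [← ofReal_integral_eq_lintegral_ofReal hint', ← intervalIntegral.integral_of_le hr,
    intervalIntegral.integral_const_mul, integral_rpow (Or.inl (by linarith))]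
  · congr 1
    rw [sub_add_cancel, Real.zero_rpow hc.ne', sub_zero]
    field_simp
  · filter_upwards [ae_restrict_mem measurableSet_Ioc] with s hs
    exact mul_nonneg hc.le (Real.rpow_nonneg hs.1.le _)

lemma exists_measure_Iio_eq_rpow {p : ℝ} (hp : 1 ≤ p) :
    ∃ η : Measure ℝ, SFinite η ∧ ∀ r : ℝ,
      η (Iio r) = if 0 < r then ENNReal.ofReal (p * r ^ (p - 1)) else 0 := by
  rcases hp.eq_or_lt with rfl | hp
  · refine ⟨Measure.dirac 0, inferInstance, fun r => ?_⟩
    rw [Measure.dirac_apply' _ measurableSet_Iio]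
    by_cases h : 0 < r <;> simp [h]
  · refine ⟨(volume.restrict (Ioi 0)).withDensity
      fun s => ENNReal.ofReal p * ENNReal.ofReal ((p - 1) * s ^ (p - 1 - 1)), inferInstance,
      fun r => ?_⟩
    have hI : Iio r ∩ Ioi (0 : ℝ) = Ioo 0 r := by ext; simp [and_comm]
    rw [withDensity_apply _ measurableSet_Iio, Measure.restrict_restrict measurableSet_Iio, hI,
      restrict_Ioo_eq_restrict_Ioc, lintegral_const_mul _ (by fun_prop)]
    split_ifs with h
    · rw [lintegral_Ioc_rpow (by linarith) h.le, ENNReal.ofReal_mul (by linarith)]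
    · rw [Ioc_eq_empty h]; simp

/-- A measure on pairs `(s, t)` representing the one-sided cost `((y - x)⁺)^p`. -/
lemma exists_measure_Ici_prod_Iio_eq_rpow {p : ℝ} (hp : 1 ≤ p) :
    ∃ m : Measure (ℝ × ℝ), SFinite m ∧ ∀ x y : ℝ,
      m (Ici x ×ˢ Iio y) = if x < y then ENNReal.ofReal ((y - x) ^ p) else 0 := by
  obtain ⟨η, hη, hI⟩ := exists_measure_Iio_eq_rpow hp
  have hmeas : Measurable fun z : ℝ × ℝ => (z.1, z.1 + z.2) := by fun_prop
  refine ⟨(volume.prod η).map fun z => (z.1, z.1 + z.2), inferInstance, fun x y => ?_⟩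
  rw [Measure.map_apply hmeas (measurableSet_Ici.prod measurableSet_Iio),
    Measure.prod_apply (hmeas (measurableSet_Ici.prod measurableSet_Iio))]
  have hslice : ∀ s : ℝ,
      η (Prod.mk s ⁻¹' ((fun z : ℝ × ℝ => (z.1, z.1 + z.2)) ⁻¹' Ici x ×ˢ Iio y))
      = (Ioc 0 (y - x)).indicator (fun r => ENNReal.ofReal (p * r ^ (p - 1))) (y - s) := by
    intro s
    by_cases hs : x ≤ s
    · have : Prod.mk s ⁻¹' ((fun z : ℝ × ℝ => (z.1, z.1 + z.2)) ⁻¹' Ici x ×ˢ Iio y)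
          = Iio (y - s) := by
        ext r; simp [hs, lt_sub_iff_add_lt']
      rw [this, hI]
      have hle : y - s ≤ y - x := by linarith
      simp only [indicator, mem_Ioc, hle, and_true]
    · have : Prod.mk s ⁻¹' ((fun z : ℝ × ℝ => (z.1, z.1 + z.2)) ⁻¹' Ici x ×ˢ Iio y) = ∅ := by
        ext r; simp [hs]
      rw [this, measure_empty, indicator_of_notMem]
      exact fun h => hs (by linarith [h.2])
  simp_rw [hslice]
  rw [lintegral_sub_left_eq_self (μ := volume)
      (fun r => (Ioc 0 (y - x)).indicator (fun r => ENNReal.ofReal (p * r ^ (p - 1))) r) y,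
    lintegral_indicator measurableSet_Ioc]
  split_ifs with h
  · exact lintegral_Ioc_rpow (by linarith) (by linarith)
  · rw [Ioc_eq_empty (by linarith)]; simp

lemma ofReal_abs_sub_rpow {p : ℝ} (hp : 0 ≤ p) (x y : ℝ) :
    ENNReal.ofReal (|x - y| ^ p) = edist x y ^ p := by
  rw [edist_dist, Real.dist_eq, ENNReal.ofReal_rpow_of_nonneg (abs_nonneg _) hp]

lemma exists_measure_edist_rpow_eq {p : ℝ} (hp : 1 ≤ p) :
    ∃ m : Measure (ℝ × ℝ), SFinite m ∧ ∀ x y : ℝ,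
      edist x y ^ p = m (Ici x ×ˢ Iio y) + m (Ici y ×ˢ Iio x) := by
  obtain ⟨m, hm, hrep⟩ := exists_measure_Ici_prod_Iio_eq_rpow hp
  refine ⟨m, hm, fun x y => ?_⟩
  rw [hrep, hrep, ← ofReal_abs_sub_rpow (by linarith)]
  rcases lt_trichotomy x y with h | rfl | h
  · rw [if_pos h, if_neg h.not_gt, add_zero, abs_sub_comm, abs_of_pos (by linarith)]
  · simp [Real.zero_rpow (by linarith : p ≠ 0)]
  · rw [if_neg h.not_gt, if_pos h, zero_add, abs_of_pos (by linarith)]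

lemma lintegral_measure_Ici_prod_Iio {Ω : Type*} [MeasurableSpace Ω] (P : Measure Ω) [SFinite P]
    (m : Measure (ℝ × ℝ)) [SFinite m] {f g : Ω → ℝ} (hf : Measurable f) (hg : Measurable g) :
    ∫⁻ ω, m (Ici (f ω) ×ˢ Iio (g ω)) ∂P = ∫⁻ z, P {ω | f ω ≤ z.1 ∧ z.2 < g ω} ∂m := by
  have hS : MeasurableSet {w : Ω × (ℝ × ℝ) | f w.1 ≤ w.2.1 ∧ w.2.2 < g w.1} := by
    measurability
  exact (Measure.prod_apply hS).symm.trans (Measure.prod_apply_symm hS)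

lemma measure_le_lt_le_of_coupling {Ω : Type*} [LinearOrder Ω] [MeasurableSpace Ω]
    {P : Measure Ω} [IsFiniteMeasure P] {I : Set Ω} (hI : ∀ᵐ ω ∂P, ω ∈ I) {f g : Ω → ℝ}
    (hf : Measurable f) (hg : Measurable g) (hfm : MonotoneOn f I) (hgm : MonotoneOn g I)
    {Ω' : Type*} [MeasurableSpace Ω'] {P' : Measure Ω'} {f' g' : Ω' → ℝ}
    (hf' : Measurable f') (hg' : Measurable g')
    (hff : P'.map f' = P.map f) (hgg : P'.map g' = P.map g) (s t : ℝ) :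
    P {ω | f ω ≤ s ∧ t < g ω} ≤ P' {ω | f' ω ≤ s ∧ t < g' ω} := by
  have hlaw : ∀ r, P' {ω | f' ω ≤ r} = P {ω | f ω ≤ r} := fun r => by
    have := congrArg (fun ρ : Measure ℝ => ρ (Iic r)) hff
    rwa [Measure.map_apply hf' measurableSet_Iic, Measure.map_apply hf measurableSet_Iic]
      at this
  have hlaw' : ∀ r, P' {ω | g' ω ≤ r} = P {ω | g ω ≤ r} := fun r => by
    have := congrArg (fun ρ : Measure ℝ => ρ (Iic r)) hgg
    rwa [Measure.map_apply hg' measurableSet_Iic, Measure.map_apply hg measurableSet_Iic]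
      at this
  have hset : {ω | f ω ≤ s ∧ t < g ω} = {ω | f ω ≤ s} \ {ω | g ω ≤ t} := by ext; simp
  have hset' : {ω | f' ω ≤ s ∧ t < g' ω} = {ω | f' ω ≤ s} \ {ω | g' ω ≤ t} := by ext; simp
  have hnested : (∀ ω ∈ I, f ω ≤ s → g ω ≤ t) ∨ (∀ ω ∈ I, g ω ≤ t → f ω ≤ s) := by
    by_contra! h
    obtain ⟨⟨ω, hω, h1, h2⟩, ω', hω', h3, h4⟩ := h
    rcases le_total ω ω' with h | h
    · exact absurd (hgm hω hω' h) (by linarith)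
    · exact absurd (hfm hω' hω h) (by linarith)
  rcases hnested with h | h
  · refine le_of_eq_of_le (measure_eq_zero_iff_ae_notMem.2 ?_) zero_le
    filter_upwards [hI] with ω hω hc
    exact absurd (h ω hω hc.1) (not_le.2 hc.2)
  · calc P {ω | f ω ≤ s ∧ t < g ω} = P {ω | f ω ≤ s} - P {ω | g ω ≤ t} := by
          have hae : {ω | g ω ≤ t} ≤ᵐ[P] {ω | f ω ≤ s} := by
            filter_upwards [hI] with ω hω using h ω hω
          rw [hset, measure_sdiff' _ (measurableSet_le hg measurable_const).nullMeasurableSet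
            (measure_ne_top _ _), measure_congr (union_ae_eq_left_iff_ae_subset.2 hae)]
      _ = P' {ω | f' ω ≤ s} - P' {ω | g' ω ≤ t} := by rw [hlaw, hlaw']
      _ ≤ P' {ω | f' ω ≤ s ∧ t < g' ω} := by rw [hset']; exact le_measure_sdiff

/-- Monotone rearrangements are optimally coupled for the cost `|x - y|^p`, `p ≥ 1`. -/
lemma lintegral_edist_rpow_le_of_monotoneOn {p : ℝ} (hp : 1 ≤ p) {Ω : Type*} [LinearOrder Ω]
    [MeasurableSpace Ω] {P : Measure Ω} [IsFiniteMeasure P] {I : Set Ω} (hI : ∀ᵐ ω ∂P, ω ∈ I)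
    {f g : Ω → ℝ} (hf : Measurable f) (hg : Measurable g) (hfm : MonotoneOn f I)
    (hgm : MonotoneOn g I) {π : Measure (ℝ × ℝ)} [SFinite π]
    (hπ : IsCoupling π (P.map f) (P.map g)) :
    ∫⁻ ω, edist (f ω) (g ω) ^ p ∂P ≤ ∫⁻ z, edist z.1 z.2 ^ p ∂π := by
  obtain ⟨m, hm, hrep⟩ := exists_measure_edist_rpow_eq hp
  have hms : Measurable fun z : ℝ × ℝ => m (Ici z.1 ×ˢ Iio z.2) :=
    measurable_measure_prodMk_left (ν := m)
      (s := {w : (ℝ × ℝ) × (ℝ × ℝ) | w.1.1 ≤ w.2.1 ∧ w.2.2 < w.1.2})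
      (by measurability)
  simp_rw [hrep]
  rw [lintegral_add_left (f := fun ω => m (Ici (f ω) ×ˢ Iio (g ω))) (hms.comp (hf.prodMk hg)),
    lintegral_add_left hms,
    lintegral_measure_Ici_prod_Iio _ _ hf hg, lintegral_measure_Ici_prod_Iio _ _ hg hf,
    lintegral_measure_Ici_prod_Iio _ _ measurable_fst measurable_snd,
    lintegral_measure_Ici_prod_Iio _ _ measurable_snd measurable_fst]
  gcongr with z z
  · exact measure_le_lt_le_of_coupling hI hf hg hfm hgm measurable_fst measurable_snd hπ.1 hπ.2 ..
  · exact measure_le_lt_le_of_coupling hI hg hf hgm hfm measurable_snd measurable_fst hπ.2 hπ.1 ..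

end MonotoneCoupling

section Quantile

/-- The quantile function of a law on `ℝ`, set to `0` off `(0,1)`. -/
noncomputable def quantileFn (ρ : Measure ℝ) (u : ℝ) : ℝ :=
  open Classical in if u ∈ Ioo (0 : ℝ) 1 then sInf {x | u ≤ cdf ρ x} else 0

lemma quantileFn_le_iff (ρ : Measure ℝ) {u : ℝ} (hu : u ∈ Ioo (0 : ℝ) 1) (t : ℝ) :
    quantileFn ρ u ≤ t ↔ u ≤ cdf ρ t := by
  rw [quantileFn, if_pos hu]
  have hne : {x | u ≤ cdf ρ x}.Nonempty :=
    ((tendsto_cdf_atTop ρ).eventually (eventually_ge_nhds hu.2)).exists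
  have hbdd : BddBelow {x | u ≤ cdf ρ x} := by
    obtain ⟨b, hb⟩ := ((tendsto_cdf_atBot ρ).eventually (eventually_lt_nhds hu.1)).exists
    refine ⟨b, fun x hx => ?_⟩
    by_contra! h
    exact absurd (monotone_cdf ρ h.le) (not_le.2 (hb.trans_le hx))
  refine ⟨fun h => ?_, fun h => csInf_le hbdd h⟩
  have hright : Tendsto (cdf ρ) (𝓝[>] t) (𝓝 (cdf ρ t)) :=
    ((cdf ρ).right_continuous t).tendsto.mono_left (nhdsWithin_mono _ Ioi_subset_Ici_self)
  refine ge_of_tendsto hright ?_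
  filter_upwards [self_mem_nhdsWithin] with s hs
  obtain ⟨x, hx, hxs⟩ := exists_lt_of_csInf_lt hne (h.trans_lt hs)
  exact le_trans hx (monotone_cdf ρ hxs.le)

lemma monotoneOn_quantileFn (ρ : Measure ℝ) : MonotoneOn (quantileFn ρ) (Ioo 0 1) :=
  fun _ hu _ hv huv => (quantileFn_le_iff ρ hu _).2 <|
    huv.trans ((quantileFn_le_iff ρ hv _).1 le_rfl)

lemma measurable_quantileFn_kernel {α : Type*} [MeasurableSpace α] (κ : Kernel α ℝ)
    [IsMarkovKernel κ] : Measurable fun z : α × ℝ => quantileFn (κ z.1) z.2 := by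
  refine measurable_of_Iic fun t => ?_
  have hset : (fun z : α × ℝ => quantileFn (κ z.1) z.2) ⁻¹' Iic t
      = {z | z.2 ∈ Ioo (0 : ℝ) 1}.ite {z | z.2 ≤ (κ z.1 (Iic t)).toReal} {_z | 0 ≤ t} := by
    ext z
    by_cases hz : z.2 ∈ Ioo (0 : ℝ) 1
    · have := quantileFn_le_iff (κ z.1) hz t
      rw [cdf_eq_real] at this
      simp only [Set.ite, mem_preimage, mem_Iic, mem_union, mem_inter_iff, Set.mem_sdiff,
        mem_ofPred_eq,
        hz, and_true, not_true, and_false, or_false]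
      exact this
    · simp only [Set.ite, mem_preimage, mem_Iic, mem_union, mem_inter_iff, Set.mem_sdiff,
        mem_ofPred_eq,
        quantileFn, hz, if_false, and_false, not_false_eq_true, and_true, false_or]
  rw [hset]
  refine MeasurableSet.ite (measurable_snd measurableSet_Ioo) ?_ (MeasurableSet.const _)
  exact measurableSet_le measurable_snd
    ((κ.measurable_coe measurableSet_Iic).comp measurable_fst).ennreal_toReal

lemma measurable_quantileFn (ρ : Measure ℝ) [IsProbabilityMeasure ρ] :
    Measurable (quantileFn ρ) :=
  (measurable_quantileFn_kernel (Kernel.const Unit ρ)).comp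
    (measurable_prodMk_left (x := ()))

lemma map_quantileFn (ρ : Measure ℝ) [IsProbabilityMeasure ρ] :
    lambda01.map (quantileFn ρ) = ρ := by
  have := Measure.isProbabilityMeasure_map (μ := lambda01) (measurable_quantileFn ρ).aemeasurable
  refine Measure.ext_of_Iic _ _ fun t => ?_
  rw [Measure.map_apply (measurable_quantileFn ρ) measurableSet_Iic, lambda01,
    Measure.restrict_apply (measurable_quantileFn ρ measurableSet_Iic)]
  have hae : (quantileFn ρ ⁻¹' Iic t ∩ Ioo 0 1 : Set ℝ) =ᵐ[volume] Ioc 0 (cdf ρ t) := by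
    have : (quantileFn ρ ⁻¹' Iic t ∩ Ioo 0 1 : Set ℝ) = Ioo 0 1 ∩ Ioc 0 (cdf ρ t) := by
      ext u
      simp only [mem_inter_iff, mem_preimage, mem_Iic, and_comm (b := u ∈ Ioo (0 : ℝ) 1)]
      exact and_congr_right fun hu => by rw [quantileFn_le_iff ρ hu]; simp [hu.1]
    rw [this]
    refine (Ioo_ae_eq_Ioc.inter (ae_eq_refl _)).trans (Filter.EventuallyEq.of_eq ?_)
    exact inter_eq_right.2 (Ioc_subset_Ioc_right (cdf_le_one _ _))
  rw [measure_congr hae, Real.volume_Ioc, sub_zero, ofReal_cdf]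

end Quantile

section Resampling

lemma ae_lambda01_mem_Ioo : ∀ᵐ t ∂lambda01, t ∈ Ioo (0 : ℝ) 1 :=
  ae_restrict_mem measurableSet_Ioo

lemma ae_lambdaN_mem_cube (N : ℕ) : ∀ᵐ u ∂lambdaN N, u ∈ cube N :=
  ae_all_iff.2 fun i => (measurePreserving_eval
    (fun _ : Fin N => lambda01) i).quasiMeasurePreserving.ae ae_lambda01_mem_Ioo

lemma measurableSet_cube (N : ℕ) : MeasurableSet (cube N) := by
  unfold cube; measurability

lemma update_mem_cube {N : ℕ} {u : Fin N → ℝ} (hu : u ∈ cube N) (k : Fin N) {t : ℝ}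
    (ht : t ∈ Ioo (0 : ℝ) 1) : Function.update u k t ∈ cube N := by
  intro i
  by_cases h : i = k
  · subst h; simpa using ht
  · simpa [h] using hu i

/-- Resampling one coordinate independently leaves the uniform law on the cube invariant. -/
lemma map_update_lambdaN {N : ℕ} (k : Fin N) :
    ((lambdaN N).prod lambda01).map (fun z => Function.update z.1 k z.2) = lambdaN N := by
  symm
  refine Measure.pi_eq fun s hs => ?_
  rw [Measure.map_apply measurable_update' (MeasurableSet.univ_pi hs)]
  have hset : (fun z : (Fin N → ℝ) × ℝ => Function.update z.1 k z.2) ⁻¹' univ.pi s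
      = univ.pi (Function.update s k univ) ×ˢ s k := by
    ext z
    simp only [mem_preimage, Set.mem_pi, mem_univ, true_implies, mem_prod]
    constructor
    · intro h
      refine ⟨fun i => ?_, by simpa using h k⟩
      by_cases hi : i = k
      · subst hi; simp
      · simpa [hi] using h i
    · rintro ⟨h, hk⟩ i
      by_cases hi : i = k
      · subst hi; simpa using hk
      · simpa [hi] using h i
  rw [hset, Measure.prod_prod, lambdaN, Measure.pi_pi,
    ← Finset.mul_prod_erase _ _ (Finset.mem_univ k),
    ← Finset.mul_prod_erase _ (fun i => lambda01 (s i)) (Finset.mem_univ k)]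
  rw [Finset.prod_congr rfl (g := fun i => lambda01 (s i)) fun i hi => by
    rw [Function.update_of_ne (Finset.ne_of_mem_erase hi)]]
  simp [mul_comm]

lemma lintegral_lambdaN_update {N : ℕ} (k : Fin N) {f : (Fin N → ℝ) → ℝ≥0∞} (hf : Measurable f) :
    ∫⁻ u, f u ∂lambdaN N = ∫⁻ u, ∫⁻ t, f (Function.update u k t) ∂lambda01 ∂lambdaN N := by
  conv_lhs => rw [← map_update_lambdaN k]
  rw [lintegral_map hf measurable_update',
    lintegral_prod (fun z => f (Function.update z.1 k z.2))
      (hf.comp measurable_update').aemeasurable]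

end Resampling

section Disintegration

lemma measurable_restr {N : ℕ} (k : Fin N) : Measurable (restr k : (Fin N → ℝ) → _) :=
  measurable_pi_lambda _ fun _ => measurable_pi_apply _

lemma disintegrates_iff_eq_compProd {α β : Type*} [MeasurableSpace α] [MeasurableSpace β]
    {ρ : Measure (α × β)} [IsFiniteMeasure ρ] {κ : Kernel α β} [IsMarkovKernel κ] :
    Disintegrates ρ κ ↔ ρ = ρ.map Prod.fst ⊗ₘ κ := by
  constructor
  · intro h
    refine Measure.ext_prod fun hs ht => ?_
    rw [h _ _ hs ht, Measure.compProd_apply_prod hs ht]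
  · intro h A B hA hB
    conv_lhs => rw [h]
    rw [Measure.compProd_apply_prod hA hB]

lemma Disintegrates.map_eq_compProd {N : ℕ} {μ : Measure (Fin N → ℝ)} [IsProbabilityMeasure μ]
    {k : Fin N} {κ : Kernel (Fin (k : ℕ) → ℝ) ℝ} [IsMarkovKernel κ]
    (h : Disintegrates (μ.map fun x => (restr k x, x k)) κ) :
    (μ.map fun x => (restr k x, x k)) = μ.map (restr k) ⊗ₘ κ := by
  have hm : Measurable fun x : Fin N → ℝ => (restr k x, x k) :=
    (measurable_restr k).prodMk (measurable_pi_apply k)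
  have := disintegrates_iff_eq_compProd.1 h
  rwa [Measure.map_map measurable_fst hm] at this

end Disintegration

section Existence

lemma map_prodMk_apply_eq_compProd {N : ℕ} {Q : (Fin N → ℝ) → Fin N → ℝ} (hQ : Measurable Q)
    {k : Fin N} {κ : Kernel (Fin (k : ℕ) → ℝ) ℝ} [IsMarkovKernel κ]
    (hκ : ∀ᵐ u ∂lambdaN N,
      lambda01.map (fun t => Q (Function.update u k t) k) = κ (restr k (Q u)))
    {β : Type*} [MeasurableSpace β] {φ : (Fin N → ℝ) → β} (hφ : Measurable φ)
    (hφk : ∀ u t, φ (Function.update u k t) = φ u)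
    {g : β → Fin (k : ℕ) → ℝ} (hg : Measurable g) (hgφ : ∀ u, g (φ u) = restr k (Q u)) :
    (lambdaN N).map (fun u => (φ u, Q u k)) = (lambdaN N).map φ ⊗ₘ κ.comap g hg := by
  have hQk : Measurable fun u => Q u k := (measurable_pi_apply k).comp hQ
  have : IsProbabilityMeasure ((lambdaN N).map φ) :=
    Measure.isProbabilityMeasure_map hφ.aemeasurable
  have := Measure.isProbabilityMeasure_map (μ := lambdaN N) (hφ.prodMk hQk).aemeasurable
  refine Measure.ext_prod fun {A B} hA hB => ?_
  rw [Measure.map_apply (hφ.prodMk hQk) (hA.prod hB), Measure.compProd_apply_prod hA hB,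
    setLIntegral_map hA (Kernel.measurable_coe _ hB) hφ,
    ← lintegral_indicator_one ((hφ.prodMk hQk) (hA.prod hB)),
    lintegral_lambdaN_update k (measurable_one.indicator ((hφ.prodMk hQk) (hA.prod hB))),
    ← lintegral_indicator (hφ hA)]
  refine lintegral_congr_ae ?_
  filter_upwards [hκ] with u hu
  have hQu : Measurable fun t => Q (Function.update u k t) k :=
    hQk.comp (measurable_update u)
  have hset : ∀ t, ((fun u => (φ u, Q u k)) ⁻¹' A ×ˢ B).indicator (1 : (Fin N → ℝ) → ℝ≥0∞)
        (Function.update u k t)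
      = (φ ⁻¹' A).indicator (fun _ => ((fun t => Q (Function.update u k t) k) ⁻¹' B).indicator
          1 t) u := by
    intro t
    by_cases h1 : φ u ∈ A <;> by_cases h2 : Q (Function.update u k t) k ∈ B <;>
      simp [indicator, hφk, h1, h2]
  simp_rw [hset]
  by_cases h1 : u ∈ φ ⁻¹' A
  · simp only [indicator_of_mem h1]
    rw [lintegral_indicator_one (hQu hB), ← Measure.map_apply hQu hB, hu, Kernel.comap_apply, hgφ]
  · simp [indicator_of_notMem h1]

/-- The triangular map with components `Q u k = G k (Q u 0, …, Q u (k-1)) (u k)`. -/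
noncomputable def triMap {N : ℕ} (G : ∀ k : Fin N, (Fin (k : ℕ) → ℝ) → ℝ → ℝ)
    (u : Fin N → ℝ) (k : Fin N) : ℝ :=
  G k (fun j => triMap G u ⟨j, j.isLt.trans k.isLt⟩) (u k)
termination_by (k : ℕ)
decreasing_by exact j.isLt

lemma triMap_apply {N : ℕ} (G : ∀ k : Fin N, (Fin (k : ℕ) → ℝ) → ℝ → ℝ)
    (u : Fin N → ℝ) (k : Fin N) : triMap G u k = G k (restr k (triMap G u)) (u k) := by
  rw [triMap]; rfl

lemma measurable_triMap {N : ℕ} {G : ∀ k : Fin N, (Fin (k : ℕ) → ℝ) → ℝ → ℝ}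
    (hG : ∀ k : Fin N, Measurable fun z : (Fin (k : ℕ) → ℝ) × ℝ => G k z.1 z.2) :
    Measurable (triMap G) := by
  refine measurable_pi_lambda _ fun k => ?_
  induction k using WellFoundedLT.induction with
  | ind k ih =>
    simp_rw [triMap_apply G _ k]
    exact (hG k).comp ((measurable_pi_lambda _ fun j : Fin (k : ℕ) =>
      ih ⟨j, j.isLt.trans k.isLt⟩ (Fin.lt_def.2 j.isLt)).prodMk (measurable_pi_apply k))

lemma triangular_triMap {N : ℕ} (G : ∀ k : Fin N, (Fin (k : ℕ) → ℝ) → ℝ → ℝ) :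
    Triangular (triMap G) := by
  intro k
  induction k using WellFoundedLT.induction with
  | ind k ih =>
    intro u v h
    rw [triMap_apply, triMap_apply, h k le_rfl]
    congr 1
    funext j
    exact ih ⟨j, j.isLt.trans k.isLt⟩ (Fin.lt_def.2 j.isLt) u v
      fun i hi => h i (hi.trans (Fin.le_def.2 j.isLt.le))

lemma Triangular.restr_congr {N : ℕ} {Q : (Fin N → ℝ) → Fin N → ℝ} (hQ : Triangular Q) {k : Fin N}
    {u v : Fin N → ℝ} (h : ∀ j < k, u j = v j) : restr k (Q u) = restr k (Q v) :=
  funext fun j => hQ _ u v fun i hi => h i (lt_of_le_of_lt hi (Fin.lt_def.2 j.isLt))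

lemma Triangular.restr_update {N : ℕ} {Q : (Fin N → ℝ) → Fin N → ℝ} (hQ : Triangular Q)
    (k : Fin N) (u : Fin N → ℝ) (t : ℝ) :
    restr k (Q (Function.update u k t)) = restr k (Q u) :=
  hQ.restr_congr fun _ hj => Function.update_of_ne hj.ne _ _

lemma isQuantileProcess_triMap {N : ℕ} {G : ∀ k : Fin N, (Fin (k : ℕ) → ℝ) → ℝ → ℝ}
    (hG : ∀ k : Fin N, Measurable fun z : (Fin (k : ℕ) → ℝ) × ℝ => G k z.1 z.2)
    (hGm : ∀ k a, MonotoneOn (G k a) (Ioo 0 1)) : IsQuantileProcess (triMap G) where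
  measurable := measurable_triMap hG
  triangular := triangular_triMap G
  inc k u hu v hv h huv := by
    rw [triMap_apply, triMap_apply, (triangular_triMap G).restr_congr h]
    exact hGm k _ (hu k) (hv k) huv
  con k m hkm u _ v _ h hQ := by
    induction m using WellFoundedLT.induction with
    | ind m ih =>
      rcases hkm.eq_or_lt with rfl | hkm
      · exact hQ
      · rw [triMap_apply, triMap_apply, h m hkm.ne']
        congr 1
        funext j
        have hj : (⟨j, j.isLt.trans m.isLt⟩ : Fin N) < m := Fin.lt_def.2 j.isLt
        rcases le_or_gt k ⟨j, j.isLt.trans m.isLt⟩ with h' | h'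
        · exact ih _ hj h'
        · exact triangular_triMap G _ _ _ fun i hi => h i (hi.trans_lt h').ne

/-- The first `n` coordinates of `x : ℝ^N`, where `n = N` is allowed. -/
def initCoords {N n : ℕ} (h : n ≤ N) (x : Fin N → ℝ) : Fin n → ℝ := fun j => x (Fin.castLE h j)

lemma measurable_initCoords {N n : ℕ} (h : n ≤ N) : Measurable (initCoords h) :=
  measurable_pi_lambda _ fun _ => measurable_pi_apply _

lemma measurable_snoc {n : ℕ} :
    Measurable fun z : (Fin n → ℝ) × ℝ => (Fin.snoc z.1 z.2 : Fin (n + 1) → ℝ) := by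
  refine measurable_pi_lambda _ fun i => ?_
  induction i using Fin.lastCases with
  | last => simpa using measurable_snd
  | cast i => simpa [Function.comp_def] using (measurable_pi_apply i).comp measurable_fst

lemma initCoords_succ {N n : ℕ} (h : n + 1 ≤ N) (x : Fin N → ℝ) :
    initCoords h x = Fin.snoc (restr ⟨n, h⟩ x) (x ⟨n, h⟩) := by
  funext i
  induction i using Fin.lastCases with
  | last => simp only [Fin.snoc_last]; rfl
  | cast i => simp only [Fin.snoc_castSucc]; rfl

/-- Two laws with the same successive conditional laws agree. -/
lemma measure_eq_of_compProd_eq {N : ℕ} {μ ν : Measure (Fin N → ℝ)} [IsProbabilityMeasure μ]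
    [IsProbabilityMeasure ν] (κ : ∀ k : Fin N, Kernel (Fin (k : ℕ) → ℝ) ℝ)
    (hμ : ∀ k, μ.map (fun x => (restr k x, x k)) = μ.map (restr k) ⊗ₘ κ k)
    (hν : ∀ k, ν.map (fun x => (restr k x, x k)) = ν.map (restr k) ⊗ₘ κ k) : μ = ν := by
  suffices H : ∀ (n : ℕ) (h : n ≤ N), μ.map (initCoords h) = ν.map (initCoords h) by
    have hid : (initCoords le_rfl : (Fin N → ℝ) → Fin N → ℝ) = id := rfl
    simpa [hid] using H N le_rfl
  intro n
  induction n with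
  | zero =>
    intro h
    have := Measure.isProbabilityMeasure_map (μ := μ) (measurable_initCoords h).aemeasurable
    have := Measure.isProbabilityMeasure_map (μ := ν) (measurable_initCoords h).aemeasurable
    ext s -
    rcases s.eq_empty_or_nonempty with rfl | hs
    · simp
    · simp [Subsingleton.eq_univ_of_nonempty hs]
  | succ n ih =>
    intro h
    have hm : Measurable fun x : Fin N → ℝ => (restr ⟨n, h⟩ x, x ⟨n, h⟩) :=
      (measurable_restr _).prodMk (measurable_pi_apply _)
    have hcomp : (initCoords h : (Fin N → ℝ) → _) = (fun z : (Fin n → ℝ) × ℝ =>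
        (Fin.snoc z.1 z.2 : Fin (n + 1) → ℝ)) ∘ fun x => (restr ⟨n, h⟩ x, x ⟨n, h⟩) :=
      funext (initCoords_succ h)
    have hrestr : μ.map (restr ⟨n, h⟩) = ν.map (restr ⟨n, h⟩) := ih (Nat.le_of_succ_le h)
    rw [hcomp, ← Measure.map_map measurable_snoc hm, ← Measure.map_map measurable_snoc hm,
      hμ, hν, hrestr]

lemma exists_isQuantileProcess {N : ℕ} {μ : Measure (Fin N → ℝ)} [IsProbabilityMeasure μ]
    {κ : ∀ k : Fin N, Kernel (Fin (k : ℕ) → ℝ) ℝ} [∀ k, IsMarkovKernel (κ k)]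
    (hκ : ∀ k : Fin N, Disintegrates (μ.map fun x => (restr k x, x k)) (κ k)) :
    ∃ Q, IsQuantileProcess Q ∧ (lambdaN N).map Q = μ := by
  set Q := triMap fun (k : Fin N) a u => quantileFn (κ k a) u with hQdef
  have hQ : IsQuantileProcess Q := isQuantileProcess_triMap
    (fun k => measurable_quantileFn_kernel (κ k)) fun _ _ => monotoneOn_quantileFn _
  have := Measure.isProbabilityMeasure_map (μ := lambdaN N) hQ.measurable.aemeasurable
  refine ⟨Q, hQ, measure_eq_of_compProd_eq κ (fun k => ?_) fun k => (hκ k).map_eq_compProd⟩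
  have hm : Measurable fun x : Fin N → ℝ => (restr k x, x k) :=
    (measurable_restr _).prodMk (measurable_pi_apply _)
  rw [Measure.map_map hm hQ.measurable, Measure.map_map (measurable_restr k) hQ.measurable]
  have hcond : ∀ u, lambda01.map (fun t => Q (Function.update u k t) k) = κ k (restr k (Q u)) := by
    intro u
    have : (fun t => Q (Function.update u k t) k) = quantileFn (κ k (restr k (Q u))) := by
      funext t
      rw [← hQ.triangular.restr_update k u t, hQdef, triMap_apply, Function.update_self]
    rw [this, map_quantileFn]
  have := map_prodMk_apply_eq_compProd hQ.measurable (ae_of_all _ hcond)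
    (φ := restr k ∘ Q) ((measurable_restr k).comp hQ.measurable)
    (hQ.triangular.restr_update k) measurable_id fun _ => rfl
  simpa [Kernel.comap_id, Function.comp_def] using this

end Existence

section ConditionalLaws

/-- Functions factoring through `φ` can be compared by integrating over preimages under `φ`. -/
lemma ae_le_of_forall_setLIntegral_preimage_eq {α β : Type*} [MeasurableSpace α]
    [StandardBorelSpace α] [TopologicalSpace β] [T2Space β] [SecondCountableTopology β]
    [MeasurableSpace β] [OpensMeasurableSpace β] {P : Measure α} {φ : α → β} (hφ : Measurable φ)
    {c : Set α} (hc : MeasurableSet c) (hPc : ∀ᵐ u ∂P, u ∈ c) {f g : α → ℝ≥0∞}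
    (hf : Measurable f) (hg : Measurable g)
    (hfφ : ∀ u ∈ c, ∀ v ∈ c, φ u = φ v → f u = f v)
    (hgφ : ∀ u ∈ c, ∀ v ∈ c, φ u = φ v → g u = g v) (hgint : ∫⁻ u, g u ∂P ≠ ⊤)
    (h : ∀ S, MeasurableSet S → ∫⁻ u in φ ⁻¹' S, f u ∂P = ∫⁻ u in φ ⁻¹' S, g u ∂P) :
    f ≤ᵐ[P] g := by
  set E : Set α := c ∩ {u | g u < f u}
  have hE : MeasurableSet E := hc.inter (measurableSet_lt hg hf)
  have hdisj : Disjoint (φ '' E) (φ '' (c \ E)) := by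
    rw [Set.disjoint_left]
    rintro _ ⟨u, hu, rfl⟩ ⟨v, hv, huv⟩
    refine hv.2 ⟨hv.1, ?_⟩
    have h1 := hfφ v hv.1 u hu.1 huv
    have h2 := hgφ v hv.1 u hu.1 huv
    simpa [h1, h2] using hu.2
  obtain ⟨S, hES, hS, hSm⟩ := (hE.analyticSet_image hφ).measurablySeparable
    ((hc.diff hE).analyticSet_image hφ) hdisj
  have hae : (φ ⁻¹' S : Set α) =ᵐ[P] E := by
    filter_upwards [hPc] with u hu
    refine propext ⟨fun huS => ?_, fun huE => hES ⟨u, huE, rfl⟩⟩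
    by_contra huE
    exact Set.disjoint_left.1 hS ⟨u, ⟨hu, huE⟩, rfl⟩ huS
  have hint := h S hSm
  rw [setLIntegral_congr hae, setLIntegral_congr hae] at hint
  have hPE : P E = 0 := by
    by_contra hne
    exact (setLIntegral_strict_mono hE hne hf
      (ne_top_of_le_ne_top hgint (setLIntegral_le_lintegral _ _))
      (ae_of_all _ fun u hu => hu.2)).ne' hint
  filter_upwards [hPc, measure_eq_zero_iff_ae_notMem.1 hPE] with u hu huE
  exact not_lt.1 fun hlt => huE ⟨hu, hlt⟩

/-- By (con), the `k`-th component depends on the earlier coordinates only through the earlier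
components. -/
lemma IsQuantileProcess.apply_update_eq {N : ℕ} {Q : (Fin N → ℝ) → Fin N → ℝ}
    (hQ : IsQuantileProcess Q) {k : Fin N} {u v : Fin N → ℝ} (hu : u ∈ cube N) (hv : v ∈ cube N)
    (huv : restr k (Q u) = restr k (Q v)) {t : ℝ} (ht : t ∈ Ioo (0 : ℝ) 1) :
    Q (Function.update u k t) k = Q (Function.update v k t) k := by
  set w : ℕ → Fin N → ℝ := fun i j => if (j : ℕ) < i then v j else Function.update u k t j
  have hw : ∀ i, w i ∈ cube N := fun i j => by
    by_cases h : (j : ℕ) < i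
    · simpa [w, h] using hv j
    · simpa [w, h] using update_mem_cube hu k ht j
  have key : ∀ i : ℕ, i ≤ k → ∀ m : Fin N, i ≤ m → Q (w i) m = Q (Function.update u k t) m := by
    intro i
    induction i with
    | zero => intro _ m _; congr 1
    | succ i ih =>
      intro hi m hm
      rw [← ih (by omega) m (by omega)]
      have hiN : i < N := by omega
      refine hQ.con ⟨i, hiN⟩ m (Fin.le_def.2 (Nat.le_of_succ_le hm)) _ (hw _) _ (hw _) ?_ ?_
      · intro j hj
        have : (j : ℕ) < i + 1 ↔ (j : ℕ) < i := by
          have : (j : ℕ) ≠ i := fun h => hj (Fin.ext h)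
          omega
        simp [w, this]
      · calc Q (w (i + 1)) ⟨i, hiN⟩ = Q v ⟨i, hiN⟩ := hQ.triangular _ _ _ fun j hj => by
              have : (j : ℕ) < i + 1 := Nat.lt_succ_of_le (Fin.le_def.1 hj)
              simp [w, this]
          _ = Q u ⟨i, hiN⟩ := (congrFun huv ⟨i, hi⟩).symm
          _ = Q (Function.update u k t) ⟨i, hiN⟩ :=
              (congrFun (hQ.triangular.restr_update k u t) ⟨i, hi⟩).symm
          _ = Q (w i) ⟨i, hiN⟩ := (ih (by omega) _ le_rfl).symm
  rw [← key k le_rfl k le_rfl]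
  refine hQ.triangular _ _ _ fun j hj => ?_
  rcases hj.eq_or_lt with rfl | hj
  · simp [w]
  · simp [w, hj, hj.ne]

lemma measure_eq_of_forall_Iic_rat {ρ σ : Measure ℝ} [IsProbabilityMeasure ρ]
    [IsProbabilityMeasure σ] (h : ∀ r : ℚ, ρ (Iic (r : ℝ)) = σ (Iic (r : ℝ))) : ρ = σ := by
  refine ext_of_generate_finite _ ((BorelSpace.measurable_eq (α := ℝ)).trans
    Real.borel_eq_generateFrom_Iic_rat) Real.isPiSystem_Iic_rat ?_ (by simp)
  simpa using h

/-- The conditional law of the `k`-th component of a quantile process for `μ` given the earlier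
ones is the conditional law under `μ`. -/
lemma IsQuantileProcess.ae_map_update_eq {N : ℕ} {Q : (Fin N → ℝ) → Fin N → ℝ}
    (hQ : IsQuantileProcess Q) {k : Fin N} {κ : Kernel (Fin (k : ℕ) → ℝ) ℝ} [IsMarkovKernel κ]
    (hκ : Disintegrates (((lambdaN N).map Q).map fun x => (restr k x, x k)) κ) :
    ∀ᵐ u ∂lambdaN N,
      lambda01.map (fun t => Q (Function.update u k t) k) = κ (restr k (Q u)) := by
  have hQk : Measurable fun u => Q u k := (measurable_pi_apply k).comp hQ.measurable
  have hR : Measurable fun u => restr k (Q u) := (measurable_restr k).comp hQ.measurable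
  have hQu : ∀ u, Measurable fun t => Q (Function.update u k t) k :=
    fun u => hQk.comp (measurable_update u)
  have hQut : Measurable fun z : (Fin N → ℝ) × ℝ => Q (Function.update z.1 k z.2) k :=
    hQk.comp measurable_update'
  suffices H : ∀ r : ℚ, ∀ᵐ u ∂lambdaN N,
      lambda01.map (fun t => Q (Function.update u k t) k) (Iic (r : ℝ))
        = κ (restr k (Q u)) (Iic (r : ℝ)) by
    filter_upwards [ae_all_iff.2 H] with u hu
    have := Measure.isProbabilityMeasure_map (μ := lambda01) (hQu u).aemeasurable
    exact measure_eq_of_forall_Iic_rat hu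
  intro r
  have hf : Measurable fun u =>
      lambda01.map (fun t => Q (Function.update u k t) k) (Iic (r : ℝ)) := by
    simp_rw [Measure.map_apply (hQu _) measurableSet_Iic]
    exact measurable_measure_prodMk_left (hQut measurableSet_Iic)
  have hg : Measurable fun u => κ (restr k (Q u)) (Iic (r : ℝ)) :=
    (κ.measurable_coe measurableSet_Iic).comp hR
  have hfφ : ∀ u ∈ cube N, ∀ v ∈ cube N, restr k (Q u) = restr k (Q v) →
      lambda01.map (fun t => Q (Function.update u k t) k) (Iic (r : ℝ))
        = lambda01.map (fun t => Q (Function.update v k t) k) (Iic (r : ℝ)) := by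
    intro u hu v hv huv
    rw [Measure.map_congr]
    filter_upwards [ae_lambda01_mem_Ioo] with t ht using hQ.apply_update_eq hu hv huv ht
  have hgφ : ∀ u ∈ cube N, ∀ v ∈ cube N, restr k (Q u) = restr k (Q v) →
      κ (restr k (Q u)) (Iic (r : ℝ)) = κ (restr k (Q v)) (Iic (r : ℝ)) :=
    fun u _ v _ huv => by rw [huv]
  have hint : ∀ S, MeasurableSet S →
      ∫⁻ u in (fun u => restr k (Q u)) ⁻¹' S,
        lambda01.map (fun t => Q (Function.update u k t) k) (Iic (r : ℝ)) ∂lambdaN N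
      = ∫⁻ u in (fun u => restr k (Q u)) ⁻¹' S, κ (restr k (Q u)) (Iic (r : ℝ)) ∂lambdaN N := by
    intro S hS
    have hm : Measurable fun x : Fin N → ℝ => (restr k x, x k) :=
      (measurable_restr k).prodMk (measurable_pi_apply k)
    have h := hκ S (Iic (r : ℝ)) hS measurableSet_Iic
    rw [Measure.map_map hm hQ.measurable,
      Measure.map_map measurable_fst (hm.comp hQ.measurable),
      Measure.map_apply (hm.comp hQ.measurable) (hS.prod measurableSet_Iic),
      setLIntegral_map hS (κ.measurable_coe measurableSet_Iic)
        (measurable_fst.comp (hm.comp hQ.measurable))] at h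
    refine Eq.trans ?_ h
    have hE : MeasurableSet (((fun x : Fin N → ℝ => (restr k x, x k)) ∘ Q) ⁻¹'
        S ×ˢ Iic (r : ℝ)) := hm.comp hQ.measurable (hS.prod measurableSet_Iic)
    rw [← lintegral_indicator_one hE, lintegral_lambdaN_update k (measurable_one.indicator hE),
      ← lintegral_indicator (hR hS)]
    refine lintegral_congr fun u => ?_
    have hset : ∀ t, (((fun x : Fin N → ℝ => (restr k x, x k)) ∘ Q) ⁻¹' S ×ˢ Iic (r : ℝ)).indicator
          (1 : (Fin N → ℝ) → ℝ≥0∞) (Function.update u k t)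
        = ((fun u => restr k (Q u)) ⁻¹' S).indicator (fun _ =>
          ((fun t => Q (Function.update u k t) k) ⁻¹' Iic (r : ℝ)).indicator 1 t) u := by
      intro t
      by_cases h1 : restr k (Q u) ∈ S <;> by_cases h2 : Q (Function.update u k t) k ≤ r <;>
        simp [indicator, hQ.triangular.restr_update k u t, h1, h2]
    simp_rw [hset]
    by_cases h1 : u ∈ (fun u => restr k (Q u)) ⁻¹' S
    · simp only [indicator_of_mem h1]
      rw [lintegral_indicator_one (hQu u measurableSet_Iic),
        ← Measure.map_apply (hQu u) measurableSet_Iic]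
    · simp only [indicator_of_notMem h1, lintegral_zero]
  have hfin : ∀ {f : (Fin N → ℝ) → ℝ≥0∞}, (∀ u, f u ≤ 1) → ∫⁻ u, f u ∂lambdaN N ≠ ⊤ :=
    fun h => ne_top_of_le_ne_top ENNReal.one_ne_top ((lintegral_mono h).trans (by simp))
  have hle := ae_le_of_forall_setLIntegral_preimage_eq hR (measurableSet_cube N)
    (ae_lambdaN_mem_cube N) hf hg hfφ hgφ (hfin fun u => prob_le_one) hint
  have hge := ae_le_of_forall_setLIntegral_preimage_eq hR (measurableSet_cube N)
    (ae_lambdaN_mem_cube N) hg hf hgφ hfφ (hfin fun u => by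
      have := Measure.isProbabilityMeasure_map (μ := lambda01) (hQu u).aemeasurable
      exact prob_le_one) fun S hS => (hint S hS).symm
  exact hle.antisymm hge

end ConditionalLaws

section Bicausal

/-- The first component of a conditional law of a pair is a conditional law of the first
component. -/
lemma ae_map_condKernel_eq {α Ω β : Type*} [MeasurableSpace α] [MeasurableSpace Ω]
    [StandardBorelSpace Ω] [Nonempty Ω] [MeasurableSpace β] [StandardBorelSpace β] [Nonempty β]
    {ρ : Measure (α × Ω)} [IsFiniteMeasure ρ] {f : Ω → β} (hf : Measurable f)
    {η : Kernel α β} [IsMarkovKernel η] (h : ρ.map (Prod.map id f) = ρ.fst ⊗ₘ η) :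
    ∀ᵐ a ∂ρ.fst, (ρ.condKernel a).map f = η a := by
  have := Kernel.IsMarkovKernel.map ρ.condKernel hf
  have key : ρ.fst ⊗ₘ ρ.condKernel.map f = ρ.fst ⊗ₘ η := by
    rw [← h, Measure.compProd_map hf, ρ.disintegrate]
  filter_upwards [Kernel.ae_eq_of_compProd_eq key] with a ha
  rw [← ha, Kernel.map_apply _ hf]

/-- The synchronous coupling of two quantile processes is bicausal. -/
lemma IsQuantileProcess.isBicausal_map_prodMk {N : ℕ} {Q R : (Fin N → ℝ) → Fin N → ℝ}
    (hQ : IsQuantileProcess Q) (hR : IsQuantileProcess R)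
    {κ η : ∀ k : Fin N, Kernel (Fin (k : ℕ) → ℝ) ℝ}
    [∀ k, IsMarkovKernel (κ k)] [∀ k, IsMarkovKernel (η k)]
    (hκ : ∀ k, Disintegrates (((lambdaN N).map Q).map fun x => (restr k x, x k)) (κ k))
    (hη : ∀ k, Disintegrates (((lambdaN N).map R).map fun x => (restr k x, x k)) (η k)) :
    IsBicausal ((lambdaN N).map Q) ((lambdaN N).map R)
      ((lambdaN N).map fun u => (Q u, R u)) := by
  have hQR : Measurable fun u => (Q u, R u) := hQ.measurable.prodMk hR.measurable
  refine ⟨⟨Measure.map_map measurable_fst hQR, Measure.map_map measurable_snd hQR⟩, fun k => ?_⟩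
  have hφ : Measurable fun xy : (Fin N → ℝ) × (Fin N → ℝ) => (restr k xy.1, restr k xy.2) :=
    ((measurable_restr k).comp measurable_fst).prodMk ((measurable_restr k).comp measurable_snd)
  have hψ : Measurable fun xy : (Fin N → ℝ) × (Fin N → ℝ) => (xy.1 k, xy.2 k) :=
    ((measurable_pi_apply k).comp measurable_fst).prodMk
      ((measurable_pi_apply k).comp measurable_snd)
  rw [Measure.map_map (hφ.prodMk hψ) hQR, Measure.map_map hφ hQR]
  set ρ := (lambdaN N).map ((fun xy : (Fin N → ℝ) × (Fin N → ℝ) =>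
    ((restr k xy.1, restr k xy.2), (xy.1 k, xy.2 k))) ∘ fun u => (Q u, R u)) with hρ
  have : IsProbabilityMeasure ρ :=
    Measure.isProbabilityMeasure_map ((hφ.prodMk hψ).comp hQR).aemeasurable
  have hfst : (lambdaN N).map ((fun xy : (Fin N → ℝ) × (Fin N → ℝ) =>
      (restr k xy.1, restr k xy.2)) ∘ fun u => (Q u, R u)) = ρ.fst := by
    rw [hρ, Measure.fst, Measure.map_map measurable_fst ((hφ.prodMk hψ).comp hQR)]
    rfl
  rw [hfst]
  refine ⟨ρ.condKernel, κ k, η k, inferInstance, inferInstance, inferInstance, hκ k, hη k,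
    disintegrates_iff_eq_compProd.2 (ρ.disintegrate ρ.condKernel).symm, ?_⟩
  have hk : ∀ u t, (restr k (Q (Function.update u k t)), restr k (R (Function.update u k t)))
      = (restr k (Q u), restr k (R u)) := fun u t => by
    rw [hQ.triangular.restr_update, hR.triangular.restr_update]
  have h1 := map_prodMk_apply_eq_compProd hQ.measurable (hQ.ae_map_update_eq (hκ k))
    (hφ.comp hQR) hk measurable_fst fun _ => rfl
  have h2 := map_prodMk_apply_eq_compProd hR.measurable (hR.ae_map_update_eq (hη k))
    (hφ.comp hQR) hk measurable_snd fun _ => rfl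
  rw [hfst] at h1 h2
  have h1' := ae_map_condKernel_eq (ρ := ρ) measurable_fst (η := (κ k).comap _ measurable_fst)
    (by rw [← h1, hρ, Measure.map_map (measurable_id.prodMap measurable_fst)
      ((hφ.prodMk hψ).comp hQR)]; rfl)
  have h2' := ae_map_condKernel_eq (ρ := ρ) measurable_snd (η := (η k).comap _ measurable_snd)
    (by rw [← h2, hρ, Measure.map_map (measurable_id.prodMap measurable_snd)
      ((hφ.prodMk hψ).comp hQR)]; rfl)
  filter_upwards [h1', h2'] with a ha hb using ⟨ha, hb⟩

lemma measurable_pCost {p : ℝ} {N : ℕ} :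
    Measurable fun xy : (Fin N → ℝ) × (Fin N → ℝ) => pCost p xy.1 xy.2 := by
  unfold pCost
  fun_prop

lemma TriLipschitz.exists_kernel {p L : ℝ} {N : ℕ} {μ : Measure (Fin N → ℝ)}
    (h : TriLipschitz p L μ) :
    ∃ κ : ∀ k : Fin N, Kernel (Fin (k : ℕ) → ℝ) ℝ, (∀ k, IsMarkovKernel (κ k)) ∧
      (∀ k, Disintegrates (μ.map fun x => (restr k x, x k)) (κ k)) ∧
      ∀ k a b, Wp p (κ k a) (κ k b)
        ≤ ENNReal.ofReal L * (∑ j, ENNReal.ofReal (|a j - b j| ^ p)) ^ p⁻¹ := by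
  choose κ h1 h2 h3 using h
  exact ⟨κ, h1, h2, h3⟩

lemma TriLipschitz.isQuantileProcess {p L : ℝ} {N : ℕ} {μ : Measure (Fin N → ℝ)}
    [IsProbabilityMeasure μ] (h : TriLipschitz p L μ) :
    IsQuantileProcess (quantileProcess μ) ∧ (lambdaN N).map (quantileProcess μ) = μ := by
  obtain ⟨κ, _, hκ, -⟩ := h.exists_kernel
  exact Classical.epsilon_spec (exists_isQuantileProcess hκ)

lemma AWdist_le_KRdist {p L : ℝ} (hp : p ≠ 0) {N : ℕ} {μ ν : Measure (Fin N → ℝ)}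
    [IsProbabilityMeasure μ] [IsProbabilityMeasure ν] (hμ : TriLipschitz p L μ)
    (hν : TriLipschitz p L ν) : AWdist p μ ν ≤ KRdist p μ ν := by
  obtain ⟨hQ, hQμ⟩ := hμ.isQuantileProcess
  obtain ⟨hR, hRν⟩ := hν.isQuantileProcess
  obtain ⟨κ, _, hκ, -⟩ := hμ.exists_kernel
  obtain ⟨η, _, hη, -⟩ := hν.exists_kernel
  have hbi := hQ.isBicausal_map_prodMk hR (κ := κ) (η := η) (by rwa [hQμ]) (by rwa [hRν])
  rw [hQμ, hRν] at hbi
  refine (iInf₂_le _ hbi).trans_eq ?_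
  rw [if_neg hp, KRdist, Ldist, if_neg hp, lintegral_map measurable_pCost
    (hQ.measurable.prodMk hR.measurable)]

end Bicausal

section LpDist

/-- The `L_p` distance of two real-valued maps. -/
noncomputable def lpDist {Ω : Type*} [MeasurableSpace Ω] (p : ℝ) (P : Measure Ω) (f g : Ω → ℝ) :
    ℝ≥0∞ :=
  (∫⁻ ω, edist (f ω) (g ω) ^ p ∂P) ^ p⁻¹

variable {Ω : Type*} [MeasurableSpace Ω] {p : ℝ} {P : Measure Ω}

lemma lpDist_triangle (hp : 1 ≤ p) {f g h : Ω → ℝ} (hf : Measurable f) (hg : Measurable g)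
    (hh : Measurable h) : lpDist p P f h ≤ lpDist p P f g + lpDist p P g h := by
  have hp0 : 0 ≤ p := by linarith
  refine le_trans (ENNReal.rpow_le_rpow (lintegral_mono fun ω => ENNReal.rpow_le_rpow
    (edist_triangle (f ω) (g ω) (h ω)) hp0) (inv_nonneg.2 hp0)) ?_
  simpa only [one_div] using! ENNReal.lintegral_Lp_add_le
    (hf.edist hg).aemeasurable (hg.edist hh).aemeasurable hp

lemma lpDist_comm (f g : Ω → ℝ) : lpDist p P f g = lpDist p P g f := by
  simp only [lpDist, edist_comm]

lemma lpDist_map {Ω' : Type*} [MeasurableSpace Ω'] {T : Ω → Ω'} (hT : Measurable T)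
    {f g : Ω' → ℝ} (hf : Measurable f) (hg : Measurable g) :
    lpDist p (P.map T) f g = lpDist p P (f ∘ T) (g ∘ T) := by
  rw [lpDist, lintegral_map ((hf.edist hg).pow_const p) hT]
  rfl

lemma sum_rpow_inv_le (hp : 1 ≤ p) {ι : Type*} (s : Finset ι) (a : ι → ℝ≥0∞) :
    (∑ i ∈ s, a i) ^ p⁻¹ ≤ ∑ i ∈ s, a i ^ p⁻¹ := by
  have hp0 : 0 < p := by linarith
  refine Finset.le_sum_of_subadditive (fun x : ℝ≥0∞ => x ^ p⁻¹)
    (ENNReal.zero_rpow_of_pos (inv_pos.2 hp0)).le (fun x y => ?_) s a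
  exact ENNReal.rpow_add_le_add_rpow x y (inv_nonneg.2 hp0.le) (inv_le_one_of_one_le₀ hp)

lemma pCost_eq_sum_edist (hp : 0 ≤ p) {N : ℕ} (x y : Fin N → ℝ) :
    pCost p x y = ∑ k, edist (x k) (y k) ^ p := by
  simp only [pCost, ofReal_abs_sub_rpow hp]

lemma lintegral_pCost_eq_sum (hp : 0 ≤ p) {N : ℕ} {f g : Ω → Fin N → ℝ} (hf : Measurable f)
    (hg : Measurable g) : ∫⁻ ω, pCost p (f ω) (g ω) ∂P
      = ∑ k, ∫⁻ ω, edist (f ω k) (g ω k) ^ p ∂P := by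
  simp only [pCost_eq_sum_edist hp]
  exact lintegral_finsetSum _ fun k _ => (((measurable_pi_apply k).comp hf).edist
    ((measurable_pi_apply k).comp hg)).pow_const p

lemma lpDist_le_lintegral_pCost (hp : 0 ≤ p) {N : ℕ} {f g : Ω → Fin N → ℝ} (k : Fin N) :
    lpDist p P (fun ω => f ω k) (fun ω => g ω k) ≤ (∫⁻ ω, pCost p (f ω) (g ω) ∂P) ^ p⁻¹ := by
  refine ENNReal.rpow_le_rpow (lintegral_mono fun ω => ?_) (inv_nonneg.2 hp)
  rw [pCost_eq_sum_edist hp]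
  exact Finset.single_le_sum (f := fun k => edist (f ω k) (g ω k) ^ p) (fun _ _ => zero_le)
    (Finset.mem_univ k)

lemma lintegral_pCost_rpow_inv_le_sum (hp : 1 ≤ p) {N : ℕ} {f g : Ω → Fin N → ℝ}
    (hf : Measurable f) (hg : Measurable g) :
    (∫⁻ ω, pCost p (f ω) (g ω) ∂P) ^ p⁻¹
      ≤ ∑ k, lpDist p P (fun ω => f ω k) (fun ω => g ω k) := by
  rw [lintegral_pCost_eq_sum (by linarith) hf hg]
  exact sum_rpow_inv_le hp _ _

end LpDist

section Step

lemma IsCoupling.isProbabilityMeasure {α β : Type*} [MeasurableSpace α] [MeasurableSpace β]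
    {π : Measure (α × β)} {μ : Measure α} [IsProbabilityMeasure μ] {ν : Measure β}
    (h : IsCoupling π μ ν) : IsProbabilityMeasure π := by
  refine ⟨?_⟩
  rw [← preimage_univ (f := Prod.fst), ← Measure.map_apply measurable_fst .univ, h.1]
  simp

lemma map_prodMap_compProd_comap {α β γ : Type*} [MeasurableSpace α] [MeasurableSpace β]
    [MeasurableSpace γ] {P : Measure α} [IsFiniteMeasure P] {f : α → β} (hf : Measurable f)
    (θ : Kernel β γ) [IsMarkovKernel θ] :
    (P ⊗ₘ θ.comap f hf).map (Prod.map f id) = P.map f ⊗ₘ θ := by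
  refine Measure.ext_prod fun {A B} hA hB => ?_
  have hpre : Prod.map f id ⁻¹' A ×ˢ B = (f ⁻¹' A) ×ˢ B := rfl
  rw [Measure.map_apply (hf.prodMap measurable_id) (hA.prod hB), hpre,
    Measure.compProd_apply_prod hA hB, setLIntegral_map hA (Kernel.measurable_coe _ hB) hf,
    Measure.compProd_apply_prod (hf hA) hB]
  rfl

lemma IsBicausal.exists_kernel {N : ℕ} {μ ν : Measure (Fin N → ℝ)} [IsProbabilityMeasure μ]
    [IsProbabilityMeasure ν] {π : Measure ((Fin N → ℝ) × (Fin N → ℝ))} (h : IsBicausal μ ν π)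
    {k : Fin N} {κ η : Kernel (Fin (k : ℕ) → ℝ) ℝ} [IsMarkovKernel κ] [IsMarkovKernel η]
    (hκ : Disintegrates (μ.map fun x => (restr k x, x k)) κ)
    (hη : Disintegrates (ν.map fun x => (restr k x, x k)) η) :
    ∃ τ : Kernel ((Fin (k : ℕ) → ℝ) × (Fin (k : ℕ) → ℝ)) (ℝ × ℝ), IsMarkovKernel τ ∧
      Disintegrates (π.map fun xy => ((restr k xy.1, restr k xy.2), (xy.1 k, xy.2 k))) τ ∧
      ∀ᵐ ab ∂(π.map fun xy => (restr k xy.1, restr k xy.2)),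
        IsCoupling (τ ab) (κ ab.1) (η ab.2) := by
  obtain ⟨⟨h1, h2⟩, h⟩ := h
  obtain ⟨τ, κ', η', hτ, _, _, hκ', hη', hdis, hτc⟩ := h k
  refine ⟨τ, hτ, hdis, ?_⟩
  have hφ : Measurable fun xy : (Fin N → ℝ) × (Fin N → ℝ) => (restr k xy.1, restr k xy.2) :=
    ((measurable_restr k).comp measurable_fst).prodMk ((measurable_restr k).comp measurable_snd)
  have e1 := Kernel.ae_eq_of_compProd_eq (hκ'.map_eq_compProd.symm.trans hκ.map_eq_compProd)
  have e2 := Kernel.ae_eq_of_compProd_eq (hη'.map_eq_compProd.symm.trans hη.map_eq_compProd)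
  have m1 : (π.map fun xy => (restr k xy.1, restr k xy.2)).map Prod.fst = μ.map (restr k) := by
    rw [Measure.map_map measurable_fst hφ, ← h1, Measure.map_map (measurable_restr k)
      measurable_fst]
    rfl
  have m2 : (π.map fun xy => (restr k xy.1, restr k xy.2)).map Prod.snd = ν.map (restr k) := by
    rw [Measure.map_map measurable_snd hφ, ← h2, Measure.map_map (measurable_restr k)
      measurable_snd]
    rfl
  rw [← m1] at e1
  rw [← m2] at e2
  filter_upwards [hτc, ae_of_ae_map measurable_fst.aemeasurable e1,
    ae_of_ae_map measurable_snd.aemeasurable e2] with ab hab ha hb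
  rwa [← ha, ← hb]

lemma lintegral_quantileFn_le_Wp {p : ℝ} (hp : 1 ≤ p) {ρ σ : Measure ℝ} [IsProbabilityMeasure ρ]
    {g : ℝ → ℝ} (hg : Measurable g) (hgm : MonotoneOn g (Ioo 0 1)) (hσ : lambda01.map g = σ) :
    ∫⁻ t, edist (quantileFn ρ t) (g t) ^ p ∂lambda01 ≤ Wp p ρ σ ^ p := by
  have hp0 : 0 < p := by linarith
  have := Measure.isProbabilityMeasure_map (μ := lambda01) hg.aemeasurable
  rw [← ENNReal.rpow_inv_le_iff hp0]
  refine le_iInf₂ fun π hπ => ENNReal.rpow_le_rpow ?_ (inv_nonneg.2 hp0.le)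
  simp only [ofReal_abs_sub_rpow hp0.le]
  have := hπ.isProbabilityMeasure
  exact lintegral_edist_rpow_le_of_monotoneOn hp ae_lambda01_mem_Ioo (measurable_quantileFn ρ) hg
    (monotoneOn_quantileFn ρ) hgm (by rwa [map_quantileFn, hσ])

lemma IsQuantileProcess.monotoneOn_update {N : ℕ} {Q : (Fin N → ℝ) → Fin N → ℝ}
    (hQ : IsQuantileProcess Q) {u : Fin N → ℝ} (hu : u ∈ cube N) (k : Fin N) :
    MonotoneOn (fun t => Q (Function.update u k t) k) (Ioo 0 1) := fun s hs t ht hst =>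
  hQ.inc k _ (update_mem_cube hu k hs) _ (update_mem_cube hu k ht)
    (fun j hj => by simp [hj.ne]) (by simpa using hst)

/-- The distance of the `k`-th components of two quantile processes is controlled by the transport
cost of a bicausal coupling and the distances of the earlier components. -/
lemma IsQuantileProcess.lpDist_le {p L : ℝ} (hp : 1 ≤ p) {N : ℕ}
    {Q R : (Fin N → ℝ) → Fin N → ℝ} (hQ : IsQuantileProcess Q) (hR : IsQuantileProcess R)
    {k : Fin N} {κ η : Kernel (Fin (k : ℕ) → ℝ) ℝ} [IsMarkovKernel κ] [IsMarkovKernel η]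
    (hκ : Disintegrates (((lambdaN N).map Q).map fun x => (restr k x, x k)) κ)
    (hη : Disintegrates (((lambdaN N).map R).map fun x => (restr k x, x k)) η)
    (hL : ∀ a b, Wp p (η a) (η b)
      ≤ ENNReal.ofReal L * (∑ j, ENNReal.ofReal (|a j - b j| ^ p)) ^ p⁻¹)
    {π : Measure ((Fin N → ℝ) × (Fin N → ℝ))}
    (hπ : IsBicausal ((lambdaN N).map Q) ((lambdaN N).map R) π) :
    lpDist p (lambdaN N) (fun u => Q u k) (fun u => R u k)
      ≤ lpDist p π (fun xy => xy.1 k) (fun xy => xy.2 k)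
        + ENNReal.ofReal L * ∑ j : Fin (k : ℕ),
          (lpDist p π (fun xy => restr k xy.1 j) (fun xy => restr k xy.2 j)
            + lpDist p (lambdaN N) (fun u => restr k (Q u) j) (fun u => restr k (R u) j)) := by
  have hp0 : 0 < p := by linarith
  have hQk : Measurable fun u => Q u k := (measurable_pi_apply k).comp hQ.measurable
  have hRk : Measurable fun u => R u k := (measurable_pi_apply k).comp hR.measurable
  have hQr : Measurable fun u => restr k (Q u) := (measurable_restr k).comp hQ.measurable
  have hRr : Measurable fun u => restr k (R u) := (measurable_restr k).comp hR.measurable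
  have := Measure.isProbabilityMeasure_map (μ := lambdaN N) hQ.measurable.aemeasurable
  have := Measure.isProbabilityMeasure_map (μ := lambdaN N) hR.measurable.aemeasurable
  have := hπ.1.isProbabilityMeasure
  obtain ⟨τ, _, hτ, hτc⟩ := hπ.exists_kernel hκ hη
  have hφ : Measurable fun xy : (Fin N → ℝ) × (Fin N → ℝ) => (restr k xy.1, restr k xy.2) :=
    ((measurable_restr k).comp measurable_fst).prodMk ((measurable_restr k).comp measurable_snd)
  have hψ : Measurable fun xy : (Fin N → ℝ) × (Fin N → ℝ) => (xy.1 k, xy.2 k) :=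
    ((measurable_pi_apply k).comp measurable_fst).prodMk
      ((measurable_pi_apply k).comp measurable_snd)
  set π' := π.map fun xy => (restr k xy.1, restr k xy.2) with hπ'
  have : IsProbabilityMeasure π' := Measure.isProbabilityMeasure_map hφ.aemeasurable
  have := Measure.isProbabilityMeasure_map (μ := π) (hφ.prodMk hψ).aemeasurable
  have hτ' : (π.map fun xy => ((restr k xy.1, restr k xy.2), (xy.1 k, xy.2 k))) = π' ⊗ₘ τ := by
    rw [disintegrates_iff_eq_compProd.1 hτ, Measure.map_map measurable_fst (hφ.prodMk hψ)]
    rfl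
  -- the auxiliary space carrying both `u` and the second half of the coupled past
  set ω := lambdaN N ⊗ₘ π'.condKernel.comap _ hQr with hω
  have hω1 : ω.map Prod.fst = lambdaN N := Measure.fst_compProd _ _
  have hω2 : ω.map (Prod.map (fun u => restr k (Q u)) id) = π' := by
    rw [hω, map_prodMap_compProd_comap hQr]
    have : (lambdaN N).map (fun u => restr k (Q u)) = π'.fst := by
      rw [hπ', Measure.fst, Measure.map_map measurable_fst hφ]
      change (lambdaN N).map (restr k ∘ Q) = π.map (restr k ∘ Prod.fst)
      rw [← Measure.map_map (measurable_restr k) hQ.measurable,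
        ← Measure.map_map (measurable_restr k) measurable_fst, hπ.1.1]
    rw [this, π'.disintegrate]
  have hmap : Measurable (Prod.map (fun u => restr k (Q u)) (id : (Fin (k : ℕ) → ℝ) → _)) :=
    hQr.prodMap measurable_id
  have hupd : Measurable fun z : ((Fin N → ℝ) × (Fin (k : ℕ) → ℝ)) × ℝ =>
      Function.update z.1.1 k z.2 :=
    measurable_update'.comp ((measurable_fst.comp measurable_fst).prodMk measurable_snd)
  have hlaw : (ω.prod lambda01).map (fun z => Function.update z.1.1 k z.2) = lambdaN N := by
    conv_rhs => rw [← map_update_lambdaN k, ← hω1, ← Measure.map_id (μ := lambda01),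
      Measure.map_prod_map _ _ measurable_fst measurable_id,
      Measure.map_map measurable_update' (measurable_fst.prodMap measurable_id)]
    rfl
  have hqm : Measurable fun z : ((Fin N → ℝ) × (Fin (k : ℕ) → ℝ)) × ℝ =>
      quantileFn (η z.1.2) z.2 :=
    (measurable_quantileFn_kernel η).comp
      ((measurable_snd.comp measurable_fst).prodMk measurable_snd)
  conv_lhs => rw [← hlaw, lpDist_map hupd hQk hRk]
  refine (lpDist_triangle hp (hQk.comp hupd) hqm (hRk.comp hupd)).trans (add_le_add ?_ ?_)
  · have hcost : Measurable fun z : ℝ × ℝ => edist z.1 z.2 ^ p :=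
      (measurable_fst.edist measurable_snd).pow_const p
    refine ENNReal.rpow_le_rpow ?_ (inv_nonneg.2 hp0.le)
    calc _ = ∫⁻ w, ∫⁻ t, edist (Q (Function.update w.1 k t) k) (quantileFn (η w.2) t) ^ p
            ∂lambda01 ∂ω := lintegral_prod _
              (((hQk.comp hupd).edist hqm).pow_const p).aemeasurable
      _ ≤ ∫⁻ w, ∫⁻ z, edist z.1 z.2 ^ p ∂τ (restr k (Q w.1), w.2) ∂ω := by
          refine lintegral_mono_ae ?_
          have hfst := ae_of_ae_map (f := Prod.fst) (μ := ω) measurable_fst.aemeasurable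
            (by rw [hω1]; exact (hQ.ae_map_update_eq hκ).and (ae_lambdaN_mem_cube N))
          rw [← hω2] at hτc
          filter_upwards [hfst, ae_of_ae_map hmap.aemeasurable hτc] with w hw hc
          refine lintegral_edist_rpow_le_of_monotoneOn hp ae_lambda01_mem_Ioo
            (hQk.comp (measurable_update w.1)) (measurable_quantileFn _)
            (hQ.monotoneOn_update hw.2 k) (monotoneOn_quantileFn _) ?_
          rw [map_quantileFn]
          exact hw.1 ▸ hc
      _ = ∫⁻ ab, ∫⁻ z, edist z.1 z.2 ^ p ∂τ ab ∂π' := by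
          rw [← hω2, lintegral_map hcost.lintegral_kernel hmap]
          rfl
      _ = ∫⁻ xy, edist (xy.1 k) (xy.2 k) ^ p ∂π := by
          refine (Measure.lintegral_compProd (hcost.comp measurable_snd)).symm.trans ?_
          rw [← hτ', lintegral_map (hcost.comp measurable_snd) (hφ.prodMk hψ)]
          rfl
  · have hj : ∀ j, Measurable fun w : (Fin N → ℝ) × (Fin (k : ℕ) → ℝ) =>
        edist (w.2 j) (restr k (R w.1) j) ^ p := fun j =>
      (((measurable_pi_apply j).comp measurable_snd).edist
        (((measurable_pi_apply j).comp hRr).comp measurable_fst)).pow_const p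
    have hle : ∫⁻ z, edist (quantileFn (η z.1.2) z.2) (R (Function.update z.1.1 k z.2) k) ^ p
          ∂ω.prod lambda01
        ≤ ENNReal.ofReal L ^ p * ∑ j, ∫⁻ w, edist (w.2 j) (restr k (R w.1) j) ^ p ∂ω := by
      rw [← lintegral_finsetSum _ fun j _ => hj j,
        ← lintegral_const_mul _ (Finset.measurable_sum _ fun j _ => hj j)]
      refine (lintegral_prod _ ((hqm.edist (hRk.comp hupd)).pow_const p).aemeasurable).trans_le
        (lintegral_mono_ae ?_)
      have hfst := ae_of_ae_map (f := Prod.fst) (μ := ω) measurable_fst.aemeasurable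
        (by rw [hω1]; exact (hR.ae_map_update_eq hη).and (ae_lambdaN_mem_cube N))
      filter_upwards [hfst] with w hw
      refine (lintegral_quantileFn_le_Wp hp (hRk.comp (measurable_update w.1))
        (hR.monotoneOn_update hw.2 k) hw.1).trans ?_
      refine (ENNReal.rpow_le_rpow (hL _ _) hp0.le).trans_eq ?_
      rw [ENNReal.mul_rpow_of_nonneg _ _ hp0.le, ENNReal.rpow_inv_rpow hp0.ne']
      simp only [ofReal_abs_sub_rpow hp0.le]
    refine (ENNReal.rpow_le_rpow hle (inv_nonneg.2 hp0.le)).trans ?_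
    rw [ENNReal.mul_rpow_of_nonneg _ _ (inv_nonneg.2 hp0.le), ENNReal.rpow_rpow_inv hp0.ne']
    refine mul_le_mul_right (((sum_rpow_inv_le hp _ _)).trans (Finset.sum_le_sum fun j _ => ?_)) _
    have hQj : Measurable fun u => restr k (Q u) j := (measurable_pi_apply j).comp hQr
    have hRj : Measurable fun u => restr k (R u) j := (measurable_pi_apply j).comp hRr
    refine (lpDist_triangle hp ((measurable_pi_apply j).comp measurable_snd)
      (hQj.comp measurable_fst) (hRj.comp measurable_fst)).trans_eq ?_
    congr 1
    · have h1 : Measurable fun ab : (Fin (k : ℕ) → ℝ) × (Fin (k : ℕ) → ℝ) => ab.1 j := by fun_prop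
      have h2 : Measurable fun ab : (Fin (k : ℕ) → ℝ) × (Fin (k : ℕ) → ℝ) => ab.2 j := by fun_prop
      rw [lpDist_comm]
      refine (lpDist_map hmap h1 h2).symm.trans ?_
      rw [hω2]
      exact lpDist_map hφ h1 h2
    · rw [← lpDist_map measurable_fst hQj hRj, hω1]

end Step

section Equivalence

lemma add_le_of_le_add_mul_sum {N : ℕ} {a l : ℝ≥0∞} {e : Fin N → ℝ≥0∞}
    (h : ∀ k : Fin N, e k ≤ a + l * ∑ j : Fin (k : ℕ), (a + e ⟨j, j.isLt.trans k.isLt⟩))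
    (k : Fin N) : a + e k ≤ 2 * (l + 1) ^ (k : ℕ) * a := by
  induction k using WellFoundedLT.induction with
  | ind k ih =>
    calc a + e k ≤ a + (a + l * ∑ j : Fin (k : ℕ), 2 * (l + 1) ^ (j : ℕ) * a) := by
          refine add_le_add_right ((h k).trans ?_) _
          gcongr with j
          exact ih ⟨j, j.isLt.trans k.isLt⟩ (Fin.lt_def.2 j.isLt)
      _ = 2 * ((∑ j ∈ Finset.range k, (l + 1) ^ j) * l + 1) * a := by
          rw [Fin.sum_univ_eq_sum_range fun j => 2 * (l + 1) ^ j * a, ← Finset.sum_mul,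
            ← Finset.mul_sum]
          ring
      _ = 2 * (l + 1) ^ (k : ℕ) * a := by rw [geom_sum_mul_add]

lemma KRdist_le_of_isBicausal {p L : ℝ} (hp : 1 ≤ p) {N : ℕ} {μ ν : Measure (Fin N → ℝ)}
    [IsProbabilityMeasure μ] [IsProbabilityMeasure ν] (hμ : TriLipschitz p L μ)
    (hν : TriLipschitz p L ν) {π : Measure ((Fin N → ℝ) × (Fin N → ℝ))}
    (hπ : IsBicausal μ ν π) :
    KRdist p μ ν ≤ (∑ k : Fin N, 2 * (ENNReal.ofReal L + 1) ^ (k : ℕ))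
      * (∫⁻ xy, pCost p xy.1 xy.2 ∂π) ^ p⁻¹ := by
  obtain ⟨hQ, hQμ⟩ := hμ.isQuantileProcess
  obtain ⟨hR, hRν⟩ := hν.isQuantileProcess
  obtain ⟨κ, _, hκ, -⟩ := hμ.exists_kernel
  obtain ⟨η, _, hη, hL⟩ := hν.exists_kernel
  have hp0 : 0 < p := by linarith
  set A := (∫⁻ xy, pCost p xy.1 xy.2 ∂π) ^ p⁻¹
  have hA : ∀ k, lpDist p π (fun xy => xy.1 k) (fun xy => xy.2 k) ≤ A :=
    lpDist_le_lintegral_pCost hp0.le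
  have hstep := add_le_of_le_add_mul_sum (a := A) (l := ENNReal.ofReal L)
    (e := fun k => lpDist p (lambdaN N) (fun u => quantileProcess μ u k)
      (fun u => quantileProcess ν u k)) fun k => by
    refine (hQ.lpDist_le hp hR (κ := κ k) (η := η k) (by rw [hQμ]; exact hκ k)
      (by rw [hRν]; exact hη k) (hL k) (by rwa [hQμ, hRν])).trans ?_
    gcongr with j
    · exact hA k
    · exact hA _
    · exact le_rfl
  rw [KRdist, Ldist, if_neg hp0.ne', Finset.sum_mul]
  exact (lintegral_pCost_rpow_inv_le_sum hp hQ.measurable hR.measurable).trans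
    (Finset.sum_le_sum fun k _ => le_add_self.trans (hstep k))

end Equivalence

/-- On the set of triangular `L`-Lipschitz measures in `P_p(ℝ^N)`, the
adapted Wasserstein and Knothe–Rosenblatt distances are equivalent:
`AW_p ≤ KR_p ≤ C · AW_p` for some constant `C > 0`. -/
theorem KR_AW_equivalent_on_triangular_Lipschitz (N : ℕ) (p L : ℝ) (hp : 1 ≤ p) (hL : 0 < L) :
    ∃ C : ℝ≥0∞, 0 < C ∧ C < ⊤ ∧
      ∀ μ ν : Measure (Fin N → ℝ), MemPp p μ → MemPp p ν →
        TriLipschitz p L μ → TriLipschitz p L ν →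
        AWdist p μ ν ≤ KRdist p μ ν ∧ KRdist p μ ν ≤ C * AWdist p μ ν := by
  have hp0 : p ≠ 0 := by linarith
  set C : ℝ≥0∞ := (∑ k : Fin N, 2 * (ENNReal.ofReal L + 1) ^ (k : ℕ)) + 1
  have hC : 0 < C := lt_of_lt_of_le one_pos le_add_self
  have hC' : C ≠ ⊤ := ENNReal.add_ne_top.2 ⟨ENNReal.sum_ne_top.2 fun k _ => by finiteness,
    ENNReal.one_ne_top⟩
  refine ⟨C, hC, hC'.lt_top, fun μ ν hμp hνp hμ hν => ?_⟩
  have := hμp.1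
  have := hνp.1
  refine ⟨AWdist_le_KRdist hp0 hμ hν, ?_⟩
  rw [← ENNReal.div_le_iff' hC.ne' hC']
  refine le_iInf₂ fun π hπ => ?_
  rw [ENNReal.div_le_iff' hC.ne' hC', if_neg hp0]
  exact (KRdist_le_of_isBicausal hp hμ hν hπ).trans (mul_le_mul_left le_self_add _)
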